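/- Let ε, σ, λ be real numbers with ε > 0, σ > 0, λ > 0 and σ·λ < π. Then (2/λ)·arsinh( ε·sinh(σ·λ) / (2·σ) ) < 4·ε. -/

import Mathlib

theorem sinh_pi_lt_four_mul_pi : Real.sinh Real.pi < 4 * Real.pi := by
  have hexp : Real.exp 3.15 < 25 := by
    refine lt_of_pow_lt_pow_left₀ 20 (by norm_num) ?_
    calc Real.exp 3.15 ^ 20 = Real.exp 1 ^ 63 := by
          rw [← Real.exp_nat_mul, ← Real.exp_nat_mul]; norm_num
      _ < 2.7182818286 ^ 63 :=
          pow_lt_pow_left₀ Real.exp_one_lt_d9 (Real.exp_pos 1).le (by norm_num)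
      _ < 25 ^ 20 := by norm_num
  have hpi := Real.exp_lt_exp.2 Real.pi_lt_d2
  rw [Real.sinh_eq]
  linarith [Real.exp_pos (-Real.pi), Real.pi_gt_d2]

theorem convexOn_sinh_Ici : ConvexOn ℝ (Set.Ici 0) Real.sinh := by
  refine MonotoneOn.convexOn_of_deriv (convex_Ici 0) Real.continuous_sinh.continuousOn
    Real.differentiable_sinh.differentiableOn ?_
  rw [interior_Ici, Real.deriv_sinh]
  exact Real.cosh_strictMonoOn.monotoneOn.mono Set.Ioi_subset_Ici_self

theorem sinh_lt_four_mul_self {t : ℝ} (ht : 0 < t) (htπ : t ≤ Real.pi) :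
    Real.sinh t < 4 * t := by
  have hslope : Real.sinh t / t ≤ Real.sinh Real.pi / Real.pi := by
    simpa using convexOn_sinh_Ici.secant_mono (a := 0) (x := t) (y := Real.pi)
      Set.self_mem_Ici ht.le Real.pi_pos.le ht.ne' Real.pi_ne_zero htπ
  rw [← div_lt_iff₀ ht]
  exact hslope.trans_lt ((div_lt_iff₀ Real.pi_pos).2 sinh_pi_lt_four_mul_pi)

theorem arsinh_lt_self {x : ℝ} (hx : 0 < x) : Real.arsinh x < x := by
  simpa using Real.arsinh_lt_arsinh.2 (Real.self_lt_sinh_iff.2 hx)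

theorem curvature_term_lt_four_eps (ε σ lam : ℝ) (hε : 0 < ε) (hσ : 0 < σ)
    (hlam : 0 < lam) (hπ : σ * lam < Real.pi) :
    (2 / lam) * Real.arsinh (ε * Real.sinh (σ * lam) / (2 * σ)) < 4 * ε := by
  have hsinh := sinh_lt_four_mul_self (mul_pos hσ hlam) hπ.le
  have harg : ε * Real.sinh (σ * lam) / (2 * σ) < 2 * ε * lam := by
    rw [div_lt_iff₀ (by positivity)]
    linarith [mul_lt_mul_of_pos_left hsinh hε]
  calc (2 / lam) * Real.arsinh (ε * Real.sinh (σ * lam) / (2 * σ))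
      < (2 / lam) * (2 * ε * lam) := by
        gcongr
        exact (Real.arsinh_lt_arsinh.2 harg).trans (arsinh_lt_self (by positivity))
    _ = 4 * ε := by field_simp; norm_num
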